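/- arXiv:1104.3060 — 4 statements merged into one kernel-verified Lean document; each statement's English description precedes it below -/
import Mathlib

section
/- Let q ∈ (0,1), β ∈ ℝ, n,p ∈ ℕ with p ≤ n, and let ω be a modulus of continuity. Then sup over f ∈ C^q_β H_ω of ‖f − V_{n,p}(f)‖_C equals (q^{n−p+1}/(πp)) · sup over φ ∈ H_ω of | ∫₀^{2π} ( φ(t) − φ(0) ) · ( Z_q²(t)/Z_{q^p}(pt) ) · cos( (n−p+1)t + 2θ_q(t) − θ_{q^p}(pt) + βπ/2 ) dt |, where Z_r(u) = 1/√(1 − 2r cos u + r²) and θ_r(u) = arctan( r sin u/(1 − r cos u) ). -/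
open Real MeasureTheory intervalIntegral

noncomputable section

/-- A modulus of continuity: continuous, nondecreasing, subadditive on `[0,∞)`, vanishing at 0. -/
def IsModulus (ω : ℝ → ℝ) : Prop :=
  ContinuousOn ω (Set.Ici 0) ∧ MonotoneOn ω (Set.Ici 0) ∧
    (∀ s t : ℝ, 0 ≤ s → 0 ≤ t → ω (s + t) ≤ ω s + ω t) ∧ ω 0 = 0

/-- A convex upwards (i.e. concave) modulus of continuity. -/
def IsConcaveModulus (ω : ℝ → ℝ) : Prop :=
  IsModulus ω ∧ ConcaveOn ℝ (Set.Ici 0) ω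

/-- The class `H_ω` of continuous `2π`-periodic functions with modulus of continuity `ω`. -/
def Hclass (ω : ℝ → ℝ) : Set (ℝ → ℝ) :=
  {φ | Continuous φ ∧ (∀ x, φ (x + 2 * π) = φ x) ∧ ∀ s t : ℝ, |φ s - φ t| ≤ ω |s - t|}

/-- The Poisson kernel `P_{q,β}(t) = Σ_{k≥1} q^k cos(kt + βπ/2)`. -/
def Pker (q β t : ℝ) : ℝ :=
  ∑' k : ℕ, q ^ (k + 1) * Real.cos ((k + 1 : ℕ) * t + β * π / 2)

/-- The class `C^q_β H_ω` of Poisson integrals of functions from `H_ω`. -/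
def CqbH (q β : ℝ) (ω : ℝ → ℝ) : Set (ℝ → ℝ) :=
  {f | ∃ A₀ : ℝ, ∃ φ ∈ Hclass ω,
      f = fun x => A₀ + (1 / π) * ∫ t in (0:ℝ)..(2 * π), φ (x + t) * Pker q β t}

/-- Fourier cosine coefficient. -/
def coefA (f : ℝ → ℝ) (j : ℕ) : ℝ := (1 / π) * ∫ t in (0:ℝ)..(2 * π), f t * Real.cos (j * t)

/-- Fourier sine coefficient. -/
def coefB (f : ℝ → ℝ) (j : ℕ) : ℝ := (1 / π) * ∫ t in (0:ℝ)..(2 * π), f t * Real.sin (j * t)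

/-- The `k`-th partial sum of the Fourier series of `f`. -/
def Ssum (f : ℝ → ℝ) (k : ℕ) (x : ℝ) : ℝ :=
  coefA f 0 / 2 +
    ∑ j ∈ Finset.Icc 1 k, (coefA f j * Real.cos (j * x) + coefB f j * Real.sin (j * x))

/-- The de la Vallée Poussin sum `V_{n,p}(f;x) = (1/p) Σ_{k=n-p}^{n-1} S_k(f;x)`. -/
def Vsum (n p : ℕ) (f : ℝ → ℝ) (x : ℝ) : ℝ :=
  (1 / (p : ℝ)) * ∑ k ∈ Finset.Ico (n - p) n, Ssum f k x

/-- `E(N; A) = sup_{f ∈ N} ‖f - A f‖_C`. -/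
def Edev (N : Set (ℝ → ℝ)) (A : (ℝ → ℝ) → ℝ → ℝ) : ℝ :=
  ⨆ f : N, ⨆ x : ℝ, |(f : ℝ → ℝ) x - A f x|

/-- The constant `K_{p,q}`. -/
def Kpq (p : ℕ) (q : ℝ) : ℝ :=
  ∫ t in (0:ℝ)..(2 * π),
    Real.sqrt (1 - 2 * q ^ p * Real.cos (p * t) + q ^ (2 * p)) /
      (1 - 2 * q * Real.cos t + q ^ 2)

/-- `e_m(ω) = ∫₀^{π/2} ω(2t/m) sin t dt`. -/
def eInt (m : ℕ) (ω : ℝ → ℝ) : ℝ := ∫ t in (0:ℝ)..(π / 2), ω (2 * t / m) * Real.sin t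

/-- `δ(p) = 2` if `p = 1`, `δ(p) = 3` otherwise. -/
def δp (p : ℕ) : ℕ := if p = 1 then 2 else 3

/-- `Z_r(u) = 1/√(1 - 2r cos u + r²)`. -/
def Zf (r u : ℝ) : ℝ := 1 / Real.sqrt (1 - 2 * r * Real.cos u + r ^ 2)

/-- `θ_r(u) = arctan(r sin u / (1 - r cos u))`. -/
def θf (r u : ℝ) : ℝ := Real.arctan (r * Real.sin u / (1 - r * Real.cos u))

/-- The complete elliptic integral of the first kind. -/
def ellK (r : ℝ) : ℝ := ∫ t in (0:ℝ)..(π / 2), 1 / Real.sqrt (1 - r ^ 2 * Real.sin t ^ 2)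

/-- `α_q = ⌊3q/(1-q)⌋ + 2`. -/
def αq (q : ℝ) : ℕ := ⌊3 * q / (1 - q)⌋₊ + 2



lemma int_cos_int (m : ℤ) (hm : m ≠ 0) (c : ℝ) :
    ∫ t in (0:ℝ)..(2 * π), Real.cos (m * t + c) = 0 := by
  have hm' : (m:ℝ) ≠ 0 := by exact_mod_cast hm
  rw [intervalIntegral.integral_comp_mul_add (fun t => Real.cos t) hm' c, integral_cos]
  have : (m:ℝ) * (2 * π) + c = c + m * (2 * π) := by ring
  rw [this, Real.sin_add_int_mul_two_pi]
  simp

lemma orth_cos (k j : ℕ) (hk : 0 < k) (a b : ℝ) :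
    ∫ s in (0:ℝ)..(2 * π), Real.cos (k * s + a) * Real.cos (j * s + b) =
      if k = j then π * Real.cos (a - b) else 0 := by
  have h1 : ∀ s : ℝ, Real.cos (k * s + a) * Real.cos (j * s + b) =
      (1/2) * Real.cos ((((k:ℤ) - j : ℤ) : ℝ) * s + (a - b)) +
      (1/2) * Real.cos ((((k:ℤ) + j : ℤ) : ℝ) * s + (a + b)) := by
    intro s
    have e1 : (((k:ℤ) - j : ℤ) : ℝ) * s + (a - b) = (k * s + a) - (j * s + b) := by
      push_cast; ring
    have e2 : (((k:ℤ) + j : ℤ) : ℝ) * s + (a + b) = (k * s + a) + (j * s + b) := by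
      push_cast; ring
    rw [e1, e2, Real.cos_sub (k * s + a), Real.cos_add (k * s + a)]; ring
  simp_rw [h1]
  rw [intervalIntegral.integral_add (by apply Continuous.intervalIntegrable; fun_prop)
    (by apply Continuous.intervalIntegrable; fun_prop), intervalIntegral.integral_const_mul,
    intervalIntegral.integral_const_mul, int_cos_int ((k:ℤ) + j) (by omega)]
  split_ifs with h
  · subst h
    simp
    ring
  · rw [int_cos_int _ (by omega)]; simp

lemma geo_int (q B : ℝ) (hq : q ∈ Set.Ioo (0:ℝ) 1) (h : ℕ → ℝ → ℝ)
    (hc : ∀ k, Continuous (h k)) (hB : ∀ k t, |h k t| ≤ B) :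
    HasSum (fun k : ℕ => q ^ (k + 1) * ∫ t in (0:ℝ)..(2 * π), h k t)
      (∫ t in (0:ℝ)..(2 * π), ∑' k : ℕ, q ^ (k + 1) * h k t) := by
  have hs : Summable (fun k : ℕ => q ^ (k + 1) * B) := by
    apply Summable.mul_right
    exact (summable_nat_add_iff 1).2 (summable_geometric_of_lt_one hq.1.le hq.2)
  have hb : ∀ (k : ℕ) (t : ℝ), ‖q ^ (k + 1) * h k t‖ ≤ q ^ (k + 1) * B := by
    intro k t
    have h0 : 0 ≤ q ^ (k + 1) := pow_nonneg hq.1.le _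
    rw [Real.norm_eq_abs, abs_mul, abs_of_nonneg h0]
    exact mul_le_mul_of_nonneg_left (hB k t) h0
  simp_rw [← intervalIntegral.integral_const_mul]
  apply intervalIntegral.hasSum_integral_of_dominated_convergence (fun k _ => q ^ (k + 1) * B)
  · intro k
    exact ((continuous_const.mul (hc k))).aestronglyMeasurable
  · intro k; exact Filter.Eventually.of_forall fun t _ => hb k t
  · exact Filter.Eventually.of_forall fun t _ => hs
  · exact intervalIntegrable_const
  · exact Filter.Eventually.of_forall fun t _ => (Summable.of_norm_bounded hs (fun k => hb k t)).hasSum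

/-- The Fourier functional of `φ`. -/
def Gf (φ : ℝ → ℝ) (b : ℝ) (k : ℕ) (x : ℝ) : ℝ :=
  ∫ t in (0:ℝ)..(2 * π), φ (x + t) * Real.cos (k * t + b)

lemma Gf_eq (φ : ℝ → ℝ) (hc : Continuous φ) (hper : ∀ x, φ (x + 2 * π) = φ x) (b : ℝ) (k : ℕ)
    (x : ℝ) : Gf φ b k x = Gf φ b k 0 * Real.cos (k * x) + Gf φ (b - π / 2) k 0 * Real.sin (k * x) := by
  have hP : Function.Periodic (fun s => φ s * Real.cos (k * (s - x) + b)) (2 * π) := by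
    intro s
    simp only
    rw [hper]
    have : (k:ℝ) * (s + 2 * π - x) + b = (k * (s - x) + b) + k * (2 * π) := by ring
    rw [this, Real.cos_add_nat_mul_two_pi]
  have h1 : Gf φ b k x = ∫ s in (0:ℝ)..(2 * π), φ s * Real.cos (k * (s - x) + b) := by
    have := hP.intervalIntegral_add_eq x 0
    rw [zero_add] at this
    rw [← this, Gf]
    have h2 := intervalIntegral.integral_comp_add_left
      (fun s => φ s * Real.cos (k * (s - x) + b)) (a := 0) (b := 2 * π) x
    rw [add_zero] at h2
    rw [← h2]
    congr 1
    ext t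
    congr 3
    ring
  rw [h1, Gf, Gf, ← intervalIntegral.integral_mul_const, ← intervalIntegral.integral_mul_const,
    ← intervalIntegral.integral_add (by apply Continuous.intervalIntegrable; fun_prop)
    (by apply Continuous.intervalIntegrable; fun_prop)]
  congr 1
  ext t
  have e1 : (k:ℝ) * (t - x) + b = (k * t + b) - k * x := by ring
  have e2 : (k:ℝ) * t + (b - π / 2) = (k * t + b) - π / 2 := by ring
  rw [e1, e2, Real.cos_sub, Real.cos_sub_pi_div_two, zero_add]
  ring

lemma Gf_orth (φ : ℝ → ℝ) (hc : Continuous φ) (hper : ∀ x, φ (x + 2 * π) = φ x) (b : ℝ) (k j : ℕ)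
    (hk : 0 < k) (c : ℝ) : ∫ s in (0:ℝ)..(2 * π), Gf φ b k s * Real.cos (j * s + c) =
     if k = j then π * (Gf φ b k 0 * Real.cos c - Gf φ (b - π / 2) k 0 * Real.sin c) else 0 := by
  have h1 : ∀ s, Gf φ b k s * Real.cos (j * s + c) =
     Gf φ b k 0 * (Real.cos (k * s + 0) * Real.cos (j * s + c)) +
     Gf φ (b - π / 2) k 0 * (Real.cos (k * s + (-(π / 2))) * Real.cos (j * s + c)) := by
    intro s
    rw [Gf_eq φ hc hper b k s, ← sub_eq_add_neg, Real.cos_sub_pi_div_two, add_zero]; ring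
  simp_rw [h1]
  rw [intervalIntegral.integral_add (by apply Continuous.intervalIntegrable; fun_prop)
    (by apply Continuous.intervalIntegrable; fun_prop), intervalIntegral.integral_const_mul,
    intervalIntegral.integral_const_mul, orth_cos k j hk, orth_cos k j hk]
  split_ifs with h
  · have : -(π / 2) - c = -(c + π / 2) := by ring
    rw [this, Real.cos_neg, Real.cos_add_pi_div_two, zero_sub, Real.cos_neg]; ring
  · simp

lemma Gf_bound (φ : ℝ → ℝ) (M : ℝ) (hM : ∀ x, |φ x| ≤ M) (b : ℝ) (k : ℕ)
    (x : ℝ) : |Gf φ b k x| ≤ M * (2 * π) := by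
  have h0 : 0 ≤ M := (abs_nonneg _).trans (hM 0)
  have := intervalIntegral.norm_integral_le_of_norm_le_const (a := 0) (b := 2 * π) (C := M)
    (f := fun t => φ (x + t) * Real.cos (k * t + b)) (by
      intro t _
      rw [Real.norm_eq_abs, abs_mul]
      calc _ ≤ M * 1 := mul_le_mul (hM _) (Real.abs_cos_le_one _) (abs_nonneg _) h0
        _ = M := mul_one _)
  rw [sub_zero, abs_of_pos Real.two_pi_pos] at this
  exact this

lemma per_bound (φ : ℝ → ℝ) (hc : Continuous φ) (hper : ∀ x, φ (x + 2 * π) = φ x) :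
    ∃ M, ∀ x, |φ x| ≤ M := by
  have hp : Function.Periodic φ (2 * π) := hper
  obtain ⟨C, hC⟩ := (hp.isBounded_of_continuous Real.two_pi_pos.ne' hc).exists_norm_le
  exact ⟨C, fun x => hC _ ⟨x, rfl⟩⟩

/-- the Poisson integral expands in a series. -/
lemma int_Pker (q β : ℝ) (hq : q ∈ Set.Ioo (0:ℝ) 1) (φ : ℝ → ℝ) (hc : Continuous φ)
    (M : ℝ) (hM : ∀ x, |φ x| ≤ M) (x : ℝ) :
    HasSum (fun k : ℕ => q ^ (k + 1) * Gf φ (β * π / 2) (k + 1) x)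
      (∫ t in (0:ℝ)..(2 * π), φ (x + t) * Pker q β t) := by
  have h0 : 0 ≤ M := (abs_nonneg _).trans (hM 0)
  have := geo_int q M hq (fun k t => φ (x + t) * Real.cos ((k + 1 : ℕ) * t + β * π / 2))
    (fun k => by fun_prop) (fun k t => by
      rw [abs_mul]
      calc _ ≤ M * 1 := mul_le_mul (hM _) (Real.abs_cos_le_one _) (abs_nonneg _) h0
        _ = M := mul_one _)
  convert this using 1
  · rfl
  apply intervalIntegral.integral_congr
  intro t _
  simp only
  rw [Pker, ← tsum_mul_left]
  congr 1
  ext k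
  ring

lemma Gf_cont (φ : ℝ → ℝ) (hc : Continuous φ) (hper : ∀ x, φ (x + 2 * π) = φ x) (b : ℝ) (k : ℕ) :
    Continuous (Gf φ b k) := by
  have : Gf φ b k = fun x => Gf φ b k 0 * Real.cos (k * x) + Gf φ (b - π / 2) k 0 * Real.sin (k * x) :=
    funext fun x => Gf_eq φ hc hper b k x
  rw [this]; fun_prop

lemma fourier_f (q β A : ℝ) (hq : q ∈ Set.Ioo (0:ℝ) 1) (φ : ℝ → ℝ) (hc : Continuous φ)
    (hper : ∀ x, φ (x + 2 * π) = φ x) (j : ℕ) (c : ℝ) :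
    ∫ s in (0:ℝ)..(2 * π), (A + (1 / π) * ∫ t in (0:ℝ)..(2 * π), φ (s + t) * Pker q β t) *
      Real.cos (j * s + c) = if j = 0 then A * (2 * π) * Real.cos c else
        q ^ j * (Gf φ (β * π / 2) j 0 * Real.cos c - Gf φ (β * π / 2 - π / 2) j 0 * Real.sin c) := by
  obtain ⟨M, hM⟩ := per_bound φ hc hper
  have hMb : 0 ≤ M * (2 * π) := (abs_nonneg _).trans (Gf_bound φ M hM 0 0 0)
  have hG := Gf_cont φ hc hper
  have hcont : Continuous (fun s => ∫ t in (0:ℝ)..(2 * π), φ (s + t) * Pker q β t) := by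
    have : (fun s => ∫ t in (0:ℝ)..(2 * π), φ (s + t) * Pker q β t) =
        fun s => ∑' k : ℕ, q ^ (k + 1) * Gf φ (β * π / 2) (k + 1) s :=
      funext fun s => (int_Pker q β hq φ hc M hM s).tsum_eq.symm
    rw [this]
    refine continuous_tsum (u := fun k => q ^ (k + 1) * (M * (2 * π)))
      (fun k => continuous_const.mul (hG _ _)) ?_ ?_
    · apply Summable.mul_right
      exact (summable_nat_add_iff 1).2 (summable_geometric_of_lt_one hq.1.le hq.2)
    · intro k t
      have h0 : 0 ≤ q ^ (k + 1) := pow_nonneg hq.1.le _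
      rw [Real.norm_eq_abs, abs_mul, abs_of_nonneg h0]
      exact mul_le_mul_of_nonneg_left (Gf_bound φ M hM _ _ t) h0
  have key : HasSum (fun k : ℕ => q ^ (k + 1) *
      ∫ s in (0:ℝ)..(2 * π), Gf φ (β * π / 2) (k + 1) s * Real.cos (j * s + c))
      (∫ s in (0:ℝ)..(2 * π), (∫ t in (0:ℝ)..(2 * π), φ (s + t) * Pker q β t) *
        Real.cos (j * s + c)) := by
    have := geo_int q (M * (2 * π)) hq
      (fun k s => Gf φ (β * π / 2) (k + 1) s * Real.cos (j * s + c))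
      (fun k => (hG _ _).mul (by fun_prop)) (fun k t => by
      rw [abs_mul]
      calc _ ≤ (M * (2 * π)) * 1 := mul_le_mul (Gf_bound φ M hM _ _ t)
            (Real.abs_cos_le_one _) (abs_nonneg _) hMb
        _ = _ := mul_one _)
    convert this using 1
    congr 1
    ext s
    rw [← (int_Pker q β hq φ hc M hM s).tsum_eq, ← tsum_mul_right]
    congr 1
    ext k
    ring
  have hsplit : ∀ s, (A + (1 / π) * ∫ t in (0:ℝ)..(2 * π), φ (s + t) * Pker q β t) *
      Real.cos (j * s + c) = A * Real.cos (j * s + c) +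
      (1 / π) * ((∫ t in (0:ℝ)..(2 * π), φ (s + t) * Pker q β t) * Real.cos (j * s + c)) := by
    intro s; ring
  simp_rw [hsplit]
  rw [intervalIntegral.integral_add (by apply Continuous.intervalIntegrable; fun_prop)
    (by apply Continuous.intervalIntegrable; fun_prop), intervalIntegral.integral_const_mul,
    intervalIntegral.integral_const_mul]
  have key2 := key
  simp_rw [fun k : ℕ => Gf_orth φ hc hper (β * π / 2) (k + 1) j (Nat.succ_pos k) c] at key2
  split_ifs with h
  · subst h
    have : (∫ s in (0:ℝ)..(2 * π), (∫ t in (0:ℝ)..(2 * π), φ (s + t) * Pker q β t) *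
        Real.cos ((0:ℕ) * s + c)) = 0 := by
      refine key2.unique ?_
      simp
    rw [this]
    simp
    ring
  · have h1 := int_cos_int (j : ℤ) (by exact_mod_cast h) c
    rw [Int.cast_natCast] at h1
    rw [h1]
    have h2 := key2.unique (hasSum_single (j - 1) (by
      intro k hk
      rw [if_neg (by omega)]; simp))
    rw [h2]
    have hj : j - 1 + 1 = j := by omega
    rw [hj, if_pos rfl]
    field_simp
    ring

lemma Ssum_f (q β A : ℝ) (hq : q ∈ Set.Ioo (0:ℝ) 1) (φ : ℝ → ℝ) (hc : Continuous φ)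
    (hper : ∀ x, φ (x + 2 * π) = φ x) (k : ℕ) (x : ℝ) :
    Ssum (fun x => A + (1 / π) * ∫ t in (0:ℝ)..(2 * π), φ (x + t) * Pker q β t) k x =
      A + (1 / π) * ∑ j ∈ Finset.Icc 1 k, q ^ j * Gf φ (β * π / 2) j x := by
  have hF := fourier_f q β A hq φ hc hper
  rw [Ssum]
  congr 1
  · have := hF 0 0
    simp only [add_zero, if_true, Real.cos_zero] at this
    rw [coefA, this]
    field_simp
  · rw [Finset.mul_sum]
    apply Finset.sum_congr rfl
    intro j hj
    have hj0 : j ≠ 0 := by have := (Finset.mem_Icc.1 hj).1; omega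
    have h1 := hF j 0
    have h2 := hF j (-(π / 2))
    rw [if_neg hj0] at h1 h2
    simp only [← sub_eq_add_neg, Real.cos_sub_pi_div_two, add_zero] at h1 h2
    rw [coefA, coefB, h1, h2, Gf_eq φ hc hper _ j x]
    simp
    ring

/-- The complex number `q e^{it}`. -/
def zq (q t : ℝ) : ℂ := q * Complex.exp (t * Complex.I)

lemma zq_norm (q t : ℝ) (hq : q ∈ Set.Ioo (0:ℝ) 1) : ‖zq q t‖ = q := by
  rw [zq, norm_mul, Complex.norm_exp_ofReal_mul_I, mul_one, Complex.norm_real, Real.norm_eq_abs,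
    abs_of_pos hq.1]

lemma zq_ne (q t : ℝ) (hq : q ∈ Set.Ioo (0:ℝ) 1) : 1 - zq q t ≠ 0 := by
  intro h
  have h1 : zq q t = 1 := (sub_eq_zero.1 h).symm
  have := zq_norm q t hq
  rw [h1, norm_one] at this
  exact absurd hq.2 (by rw [← this]; exact lt_irrefl _)

lemma zq_pow (q t : ℝ) (k : ℕ) : zq q t ^ k = zq (q ^ k) (k * t) := by
  rw [zq, zq, mul_pow, ← Complex.exp_nat_mul]
  push_cast
  ring_nf

lemma re_zq (q t b : ℝ) : (Complex.exp (b * Complex.I) * zq q t).re = q * Real.cos (t + b) := by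
  have : Complex.exp (b * Complex.I) * zq q t =
      (q:ℂ) * Complex.exp (((t + b : ℝ) : ℂ) * Complex.I) := by
    rw [zq, mul_left_comm, ← Complex.exp_add]; push_cast; ring_nf
  rw [this, Complex.re_ofReal_mul, Complex.exp_ofReal_mul_I_re]

lemma Pker_eq (q β t : ℝ) (hq : q ∈ Set.Ioo (0:ℝ) 1) :
    Pker q β t = (Complex.exp ((β * π / 2 : ℝ) * Complex.I) * (zq q t / (1 - zq q t))).re := by
  have hlt : ‖zq q t‖ < 1 := by rw [zq_norm q t hq]; exact hq.2
  have h1 := (hasSum_geometric_of_norm_lt_one hlt).mul_left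
    (Complex.exp ((β * π / 2 : ℝ) * Complex.I) * zq q t)
  have h2 := Complex.hasSum_re h1
  rw [div_eq_mul_inv (zq q t), ← mul_assoc, ← h2.tsum_eq, Pker]
  congr 1
  ext k
  rw [mul_assoc, ← pow_succ', zq_pow, re_zq]

lemma psum_eq (q b t : ℝ) (hq : q ∈ Set.Ioo (0:ℝ) 1) (k : ℕ) :
    ∑ j ∈ Finset.Icc 1 k, q ^ j * Real.cos (j * t + b) =
     (Complex.exp (b * Complex.I) * ((zq q t - zq q t ^ (k + 1)) / (1 - zq q t))).re := by
  have hne := zq_ne q t hq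
  induction k with
  | zero => simp
  | succ k ih =>
    rw [Finset.sum_Icc_succ_top (by omega), ih, ← re_zq, ← zq_pow, ← Complex.add_re, ← mul_add]
    congr 2
    field_simp
    ring

lemma polar (r u : ℝ) (hr : r ∈ Set.Ioo (0:ℝ) 1) :
    1 - zq r u = (1 / Zf r u : ℝ) * Complex.exp (((-θf r u : ℝ) : ℂ) * Complex.I) := by
  have hpos : 0 < 1 - r * Real.cos u := by
    have := Real.cos_le_one u
    nlinarith [hr.1, hr.2]
  set a := 1 - r * Real.cos u with ha
  set s := r * Real.sin u with hs
  have hD : 1 - 2 * r * Real.cos u + r ^ 2 = a ^ 2 + s ^ 2 := by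
    rw [ha, hs]; nlinarith [Real.sin_sq_add_cos_sq u]
  have hsq : Real.sqrt (1 + (s / a) ^ 2) = Real.sqrt (a ^ 2 + s ^ 2) / a := by
    have : 1 + (s / a) ^ 2 = (a ^ 2 + s ^ 2) / a ^ 2 := by field_simp
    rw [this, Real.sqrt_div (by positivity), Real.sqrt_sq hpos.le]
  have hR : 0 < Real.sqrt (a ^ 2 + s ^ 2) := Real.sqrt_pos.2 (by positivity)
  have hre : (1 - zq r u).re = a := by
    rw [zq, Complex.sub_re, Complex.re_ofReal_mul, Complex.exp_ofReal_mul_I_re, Complex.one_re]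
  have him : (1 - zq r u).im = -s := by
    rw [zq, Complex.sub_im, Complex.im_ofReal_mul, Complex.exp_ofReal_mul_I_im, Complex.one_im,
      zero_sub]
  apply Complex.ext
  · rw [hre, Complex.re_ofReal_mul, Complex.exp_ofReal_mul_I_re, Real.cos_neg, Zf, θf, ← ha, ← hs,
      hD, Real.cos_arctan, hsq]
    field_simp
  · rw [him, Complex.im_ofReal_mul, Complex.exp_ofReal_mul_I_im, Real.sin_neg, Zf, θf, ← ha, ← hs,
      hD, Real.sin_arctan, hsq]
    field_simp

lemma Zf_pos (r u : ℝ) (hr : r ∈ Set.Ioo (0:ℝ) 1) : 0 < Zf r u := by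
  have : 0 < 1 - 2 * r * Real.cos u + r ^ 2 := by
    nlinarith [Real.cos_le_one u, hr.1, hr.2, mul_nonneg hr.1.le (sub_nonneg.2 (Real.cos_le_one u)),
      pow_pos (sub_pos.2 hr.2) 2]
  exact one_div_pos.2 (Real.sqrt_pos.2 this)

lemma kernel_eq (q β t : ℝ) (hq : q ∈ Set.Ioo (0:ℝ) 1) (n p : ℕ) (hp : 0 < p) (hpn : p ≤ n) :
    p * Pker q β t - ∑ k ∈ Finset.Ico (n - p) n, ∑ j ∈ Finset.Icc 1 k,
        q ^ j * Real.cos (j * t + β * π / 2) =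
      q ^ (n - p + 1) * ((Zf q t) ^ 2 / Zf (q ^ p) ((p : ℝ) * t) *
                Real.cos (((n - p + 1 : ℕ) : ℝ) * t + 2 * θf q t -
                  θf (q ^ p) ((p : ℝ) * t) + β * π / 2)) := by
  obtain ⟨m, rfl⟩ := Nat.exists_eq_add_of_le hpn
  have hqp : q ^ p ∈ Set.Ioo (0:ℝ) 1 := ⟨pow_pos hq.1 _, pow_lt_one₀ hq.1.le hq.2 hp.ne'⟩
  have hne := zq_ne q t hq
  have hm : p + m - p = m := by omega
  rw [hm]
  set E := Complex.exp ((β * π / 2 : ℝ) * Complex.I) with hE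
  have h1 : ∀ p : ℕ, p * Pker q β t - ∑ k ∈ Finset.Ico m (p + m), ∑ j ∈ Finset.Icc 1 k,
        q ^ j * Real.cos (j * t + β * π / 2) =
      (E * (zq q t ^ (m + 1) * (1 - zq q t ^ p) / (1 - zq q t) ^ 2)).re := by
    intro p
    induction p with
    | zero => simp
    | succ p ih =>
      rw [show p + 1 + m = p + m + 1 by ring, Finset.sum_Ico_succ_top (by omega),
        psum_eq q _ t hq (p + m)]
      have : ((p + 1 : ℕ) : ℝ) * Pker q β t = p * Pker q β t + Pker q β t := by push_cast; ring
      rw [this, add_sub_add_comm, ih, Pker_eq q β t hq, ← hE, ← Complex.sub_re, ← Complex.add_re,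
        ← mul_sub, ← mul_add]
      congr 2
      field_simp
      ring
  rw [h1 p]
  have hZ := Zf_pos q t hq
  have hZp := Zf_pos (q ^ p) (p * t) hqp
  have h2 : E * (zq q t ^ (m + 1) * (1 - zq q t ^ p) / (1 - zq q t) ^ 2) =
     ((Zf q t) ^ 2 / Zf (q ^ p) ((p : ℝ) * t) : ℝ) *
      (Complex.exp ((2 * θf q t - θf (q ^ p) (p * t) + β * π / 2 : ℝ) * Complex.I) *
        zq (q ^ (m + 1)) ((m + 1 : ℕ) * t)) := by
    rw [zq_pow q t p, polar q t hq, polar _ _ hqp, ← zq_pow, hE]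
    have e1 : Complex.exp ((2 * θf q t - θf (q ^ p) (p * t) + β * π / 2 : ℝ) * Complex.I) =
      Complex.exp ((-θf (q ^ p) (p * t) : ℝ) * Complex.I) *
      Complex.exp ((β * π / 2 : ℝ) * Complex.I) /
      Complex.exp ((-θf q t : ℝ) * Complex.I) ^ 2 := by
      rw [← Complex.exp_nat_mul, ← Complex.exp_add, ← Complex.exp_sub]
      push_cast; ring_nf
    rw [e1]
    have := Complex.exp_ne_zero ((-θf q t : ℝ) * Complex.I)
    have hZ' : (Zf q t : ℂ) ≠ 0 := by exact_mod_cast hZ.ne'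
    have hZp' : (Zf (q ^ p) (p * t) : ℂ) ≠ 0 := by exact_mod_cast hZp.ne'
    push_cast at *
    field_simp
  rw [h2, Complex.re_ofReal_mul, re_zq]
  rw [← add_assoc, ← add_sub_assoc]
  ring

/-- the kernel in the statement. -/
def Kst (q β : ℝ) (n p : ℕ) (t : ℝ) : ℝ := (Zf q t) ^ 2 / Zf (q ^ p) ((p : ℝ) * t) *
                Real.cos (((n - p + 1 : ℕ) : ℝ) * t + 2 * θf q t -
                  θf (q ^ p) ((p : ℝ) * t) + β * π / 2)

lemma Pker_cont (q β : ℝ) (hq : q ∈ Set.Ioo (0:ℝ) 1) : Continuous (Pker q β) := by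
  refine continuous_tsum (u := fun k => q ^ (k + 1)) (fun k => by fun_prop) ?_ ?_
  · exact (summable_nat_add_iff 1).2 (summable_geometric_of_lt_one hq.1.le hq.2)
  · intro k t
    have h0 : 0 ≤ q ^ (k + 1) := pow_nonneg hq.1.le _
    rw [Real.norm_eq_abs, abs_mul, abs_of_nonneg h0]
    exact mul_le_of_le_one_right h0 (Real.abs_cos_le_one _)

lemma Kst_eq (q β : ℝ) (hq : q ∈ Set.Ioo (0:ℝ) 1) (n p : ℕ) (hp : 0 < p) (hpn : p ≤ n) (t : ℝ) :
    q ^ (n - p + 1) * Kst q β n p t =  p * Pker q β t -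
      ∑ k ∈ Finset.Ico (n - p) n, ∑ j ∈ Finset.Icc 1 k, q ^ j * Real.cos (j * t + β * π / 2) :=
  (kernel_eq q β t hq n p hp hpn).symm

lemma Kst_cont (q β : ℝ) (hq : q ∈ Set.Ioo (0:ℝ) 1) (n p : ℕ) (hp : 0 < p) (hpn : p ≤ n) :
    Continuous (Kst q β n p) := by
  have hqn : q ^ (n - p + 1) ≠ 0 := (pow_pos hq.1 _).ne'
  have : Kst q β n p = fun t => (q ^ (n - p + 1))⁻¹ * (p * Pker q β t -
      ∑ k ∈ Finset.Ico (n - p) n, ∑ j ∈ Finset.Icc 1 k, q ^ j * Real.cos (j * t + β * π / 2)) := by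
    funext t
    rw [← Kst_eq q β hq n p hp hpn t]
    field_simp
  rw [this]
  have := Pker_cont q β hq
  fun_prop

lemma int_Kst (q β : ℝ) (hq : q ∈ Set.Ioo (0:ℝ) 1) (n p : ℕ) (hp : 0 < p) (hpn : p ≤ n)
    (φ : ℝ → ℝ) (hc : Continuous φ) (x : ℝ) :
    q ^ (n - p + 1) * ∫ t in (0:ℝ)..(2 * π), φ (x + t) * Kst q β n p t =
      p * (∫ t in (0:ℝ)..(2 * π), φ (x + t) * Pker q β t) -
      ∑ k ∈ Finset.Ico (n - p) n, ∑ j ∈ Finset.Icc 1 k, q ^ j * Gf φ (β * π / 2) j x := by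
  have hP := Pker_cont q β hq
  rw [← intervalIntegral.integral_const_mul, ← intervalIntegral.integral_const_mul]
  simp_rw [Gf, ← intervalIntegral.integral_const_mul]
  have h1 : ∀ k : ℕ, ∑ j ∈ Finset.Icc 1 k,
      ∫ t in (0:ℝ)..(2 * π), q ^ j * (φ (x + t) * Real.cos (j * t + β * π / 2)) =
      ∫ t in (0:ℝ)..(2 * π), ∑ j ∈ Finset.Icc 1 k,
        q ^ j * (φ (x + t) * Real.cos (j * t + β * π / 2)) := by
    intro k
    rw [intervalIntegral.integral_finsetSum]
    intro j _
    apply Continuous.intervalIntegrable; fun_prop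
  simp_rw [h1]
  rw [← intervalIntegral.integral_finsetSum
    (fun k _ => by apply Continuous.intervalIntegrable; fun_prop),
    ← intervalIntegral.integral_sub (by apply Continuous.intervalIntegrable; fun_prop)
    (by apply Continuous.intervalIntegrable; fun_prop)]
  congr 1
  ext t
  rw [mul_left_comm, Kst_eq q β hq n p hp hpn t, mul_sub, Finset.mul_sum]
  congr 1
  · ring
  · apply Finset.sum_congr rfl
    intro k _
    rw [Finset.mul_sum]
    apply Finset.sum_congr rfl
    intro j _
    ring

lemma int_Kst_zero (q β : ℝ) (hq : q ∈ Set.Ioo (0:ℝ) 1) (n p : ℕ) (hp : 0 < p) (hpn : p ≤ n) :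
    ∫ t in (0:ℝ)..(2 * π), Kst q β n p t = 0 := by
  have h := int_Kst q β hq n p hp hpn (fun _ => 1) continuous_const 0
  have hG : ∀ j : ℕ, 0 < j → Gf (fun _ => 1) (β * π / 2) j 0 = 0 := by
    intro j hj
    have h1 := int_cos_int (j : ℤ) (by exact_mod_cast hj.ne') (β * π / 2)
    rw [Int.cast_natCast] at h1
    simpa [Gf] using h1
  have hP : (∫ t in (0:ℝ)..(2 * π), (fun _ => (1:ℝ)) (0 + t) * Pker q β t) = 0 := by
    have := int_Pker q β hq (fun _ => 1) continuous_const 1 (by simp) 0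
    simp_rw [fun k : ℕ => hG (k + 1) (Nat.succ_pos k), mul_zero] at this
    exact this.unique hasSum_zero
  rw [hP, Finset.sum_eq_zero (fun k _ => Finset.sum_eq_zero (fun j hj => by
    rw [hG j (by have := (Finset.mem_Icc.1 hj).1; omega), mul_zero]))] at h
  have hqn : q ^ (n - p + 1) ≠ 0 := (pow_pos hq.1 _).ne'
  simpa [hq.1.ne'] using h

lemma dev_eq (q β A : ℝ) (hq : q ∈ Set.Ioo (0:ℝ) 1) (n p : ℕ) (hp : 0 < p) (hpn : p ≤ n)
    (φ : ℝ → ℝ) (hc : Continuous φ) (hper : ∀ x, φ (x + 2 * π) = φ x) (x : ℝ) :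
    (A + (1 / π) * ∫ t in (0:ℝ)..(2 * π), φ (x + t) * Pker q β t) -
      Vsum n p (fun x => A + (1 / π) * ∫ t in (0:ℝ)..(2 * π), φ (x + t) * Pker q β t) x =
    q ^ (n - p + 1) / (π * (p : ℝ)) *
      ∫ t in (0:ℝ)..(2 * π), (φ (x + t) - φ (x + 0)) * Kst q β n p t := by
  have hK := Kst_cont q β hq n p hp hpn
  have hp' : (p:ℝ) ≠ 0 := by exact_mod_cast hp.ne'
  have h1 : ∫ t in (0:ℝ)..(2 * π), (φ (x + t) - φ (x + 0)) * Kst q β n p t =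
      ∫ t in (0:ℝ)..(2 * π), φ (x + t) * Kst q β n p t := by
    simp_rw [sub_mul]
    rw [intervalIntegral.integral_sub (by apply Continuous.intervalIntegrable; fun_prop)
      (by apply Continuous.intervalIntegrable; fun_prop), intervalIntegral.integral_const_mul,
      int_Kst_zero q β hq n p hp hpn, mul_zero, sub_zero]
  rw [h1, div_mul_eq_mul_div (q ^ (n - p + 1)), int_Kst q β hq n p hp hpn φ hc x, Vsum]
  simp_rw [Ssum_f q β A hq φ hc hper]
  rw [Finset.sum_add_distrib, ← Finset.mul_sum, Finset.sum_const, Nat.card_Ico, nsmul_eq_mul,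
    show n - (n - p) = p by omega]
  field_simp
  ring

/-- The supremum of deviations of de la Vallée Poussin sums over `C^q_β H_ω` equals
`(q^{n-p+1}/(πp))` times the supremum of the corresponding integrals over `H_ω`. -/
theorem sup_deviation_eq_sup_integral (q β : ℝ) (hq : q ∈ Set.Ioo (0:ℝ) 1)
    (n p : ℕ) (hp : 0 < p) (hpn : p ≤ n) (ω : ℝ → ℝ) (hω : IsModulus ω) :
    Edev (CqbH q β ω) (Vsum n p) =
      q ^ (n - p + 1) / (π * (p : ℝ)) *
        ⨆ φ : (Hclass ω),
          |∫ t in (0:ℝ)..(2 * π),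
            ((φ : ℝ → ℝ) t - (φ : ℝ → ℝ) 0) *
              ((Zf q t) ^ 2 / Zf (q ^ p) ((p : ℝ) * t)) *
                Real.cos (((n - p + 1 : ℕ) : ℝ) * t + 2 * θf q t -
                  θf (q ^ p) ((p : ℝ) * t) + β * π / 2)| := by
  have hK := Kst_cont q β hq n p hp hpn
  obtain ⟨hωc, hωm, hωs, hω0⟩ := hω
  have hc0 : 0 ≤ q ^ (n - p + 1) / (π * (p : ℝ)) :=
    div_nonneg (pow_nonneg hq.1.le _) (by positivity)
  set c := q ^ (n - p + 1) / (π * (p : ℝ)) with hcdef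
  have hpos := Real.two_pi_pos
  simp_rw [mul_assoc (_ - _) _ (Real.cos _)]
  change _ = c * ⨆ φ : (Hclass ω), |∫ t in (0:ℝ)..(2 * π),
            ((φ : ℝ → ℝ) t - (φ : ℝ → ℝ) 0) * Kst q β n p t|
  let J : (ℝ → ℝ) → ℝ := fun φ => |∫ t in (0:ℝ)..(2 * π), (φ t - φ 0) * Kst q β n p t|
  change _ = c * ⨆ φ : (Hclass ω), J φ
  have hshift : ∀ φ ∈ Hclass ω, ∀ x : ℝ, (fun t => φ (x + t)) ∈ Hclass ω := by
    rintro φ ⟨h1, h2, h3⟩ x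
    refine ⟨by fun_prop, fun t => ?_, fun s t => ?_⟩
    · simp only; rw [← add_assoc, h2]
    · simpa using h3 (x + s) (x + t)
  have hzero : (fun _ => 0 : ℝ → ℝ) ∈ Hclass ω := by
    refine ⟨continuous_const, fun _ => rfl, fun s t => ?_⟩
    rw [sub_self, abs_zero, ← hω0]
    exact hωm Set.self_mem_Ici (Set.mem_Ici.2 (abs_nonneg _)) (abs_nonneg _)
  have : Nonempty (Hclass ω) := ⟨⟨_, hzero⟩⟩
  have : Nonempty (CqbH q β ω) := ⟨⟨_, 0, _, hzero, rfl⟩⟩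
  obtain ⟨B, hB⟩ := isCompact_Icc.exists_bound_of_continuousOn
    (hK.continuousOn (s := Set.Icc 0 (2 * π)))
  have hJ : ∀ φ ∈ Hclass ω, J φ ≤ ω (2 * π) * B * (2 * π) := by
    rintro φ ⟨h1, h2, h3⟩
    have := intervalIntegral.norm_integral_le_of_norm_le_const (a := 0) (b := 2 * π)
      (C := ω (2 * π) * B) (f := fun t => (φ t - φ 0) * Kst q β n p t) (by
      intro t ht
      rw [Set.uIoc_of_le hpos.le] at ht
      rw [Real.norm_eq_abs, abs_mul]
      have e : |φ t - φ 0| ≤ ω (2 * π) := by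
        refine (h3 t 0).trans (hωm (Set.mem_Ici.2 (abs_nonneg _)) (Set.mem_Ici.2 hpos.le) ?_)
        rw [sub_zero, abs_of_pos ht.1]; exact ht.2
      exact mul_le_mul e (hB t ⟨ht.1.le, ht.2⟩) (abs_nonneg _) ((abs_nonneg _).trans e))
    rwa [sub_zero, abs_of_pos hpos] at this
  have hbdd : BddAbove (Set.range fun φ : Hclass ω => J φ) :=
    ⟨_, by rintro _ ⟨φ, rfl⟩; exact hJ φ φ.2⟩
  have hdev : ∀ (A : ℝ), ∀ φ ∈ Hclass ω, ∀ x : ℝ,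
      |(A + (1 / π) * ∫ t in (0:ℝ)..(2 * π), φ (x + t) * Pker q β t) -
      Vsum n p (fun x => A + (1 / π) * ∫ t in (0:ℝ)..(2 * π), φ (x + t) * Pker q β t) x| =
      c * J (fun t => φ (x + t)) := by
    intro A φ hφ x
    rw [dev_eq q β A hq n p hp hpn φ hφ.1 hφ.2.1 x, abs_mul, abs_of_nonneg hc0]
  have hle : ∀ f ∈ CqbH q β ω, ∀ x : ℝ, |f x - Vsum n p f x| ≤ c * ⨆ φ : (Hclass ω), J φ := by
    rintro f ⟨A, φ, hφ, rfl⟩ x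
    rw [hdev A φ hφ x]
    exact mul_le_mul_of_nonneg_left (le_ciSup hbdd ⟨_, hshift φ hφ x⟩) hc0
  have hle2 : ∀ f : CqbH q β ω, (⨆ x : ℝ, |(f : ℝ → ℝ) x - Vsum n p f x|) ≤
      c * ⨆ φ : (Hclass ω), J φ := fun f => ciSup_le (hle f f.2)
  apply le_antisymm
  · exact ciSup_le hle2
  · rw [Real.mul_iSup_of_nonneg hc0]
    apply ciSup_le
    rintro ⟨φ, hφ⟩
    let f : CqbH q β ω := ⟨_, 0, φ, hφ, rfl⟩
    have h1 := hdev 0 φ hφ 0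
    simp only [zero_add] at h1
    calc c * J φ = |(f : ℝ → ℝ) 0 - Vsum n p f 0| := by
          have := hdev 0 φ hφ 0
          have e : (fun t => φ (0 + t)) = φ := by funext t; rw [zero_add]
          rw [e] at this
          exact this.symm
      _ ≤ ⨆ x : ℝ, |(f : ℝ → ℝ) x - Vsum n p f x| :=
          le_ciSup (f := fun x : ℝ => |(f : ℝ → ℝ) x - Vsum n p f x|)
            ⟨_, by rintro _ ⟨x, rfl⟩; exact hle f f.2 x⟩ 0
      _ ≤ _ := le_ciSup (f := fun f : CqbH q β ω => ⨆ x : ℝ, |(f : ℝ → ℝ) x - Vsum n p f x|)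
            ⟨_, by rintro _ ⟨g, rfl⟩; exact hle2 g⟩ f
end
end

section
/- For every q ∈ (0,1), p ∈ ℕ and t ∈ ℝ, one has Z_q²(t)/Z_{q^p}(pt) = √(1 − 2q^p cos(pt) + q^{2p}) / (1 − 2q cos t + q²) ≤ 2/(1 − q)^{δ(p)−1}, where δ(p) = 2 if p = 1 and δ(p) = 3 if p ≥ 2; moreover for p = 1 the sharper bound Z_q(t) ≤ 1/(1 − q) holds. -/
open Real MeasureTheory intervalIntegral

noncomputable section

/-- `Z_q²(t)/Z_{q^p}(pt) = √(1-2q^p cos pt + q^{2p})/(1-2q cos t + q²) ≤ 2/(1-q)^{δ(p)-1}`,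
and for `p = 1` the sharper bound `Z_q(t) ≤ 1/(1-q)` holds. -/
theorem Zq_ratio_bound (q : ℝ) (hq : q ∈ Set.Ioo (0:ℝ) 1) (p : ℕ) (hp : 0 < p) (t : ℝ) :
    (Zf q t) ^ 2 / Zf (q ^ p) ((p : ℝ) * t) =
        Real.sqrt (1 - 2 * q ^ p * Real.cos ((p : ℝ) * t) + q ^ (2 * p)) /
          (1 - 2 * q * Real.cos t + q ^ 2) ∧
      (Zf q t) ^ 2 / Zf (q ^ p) ((p : ℝ) * t) ≤ 2 / (1 - q) ^ (δp p - 1) ∧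
      (p = 1 → Zf q t ≤ 1 / (1 - q)) := by
  obtain ⟨h0, h1⟩ := hq
  have hD : (1 - q) ^ 2 ≤ 1 - 2 * q * Real.cos t + q ^ 2 := by
    nlinarith [Real.cos_le_one t]
  have hq1 : 0 < 1 - q := by linarith
  have hDpos : 0 < 1 - 2 * q * Real.cos t + q ^ 2 := lt_of_lt_of_le (by positivity) hD
  have hsD : 1 - q ≤ Real.sqrt (1 - 2 * q * Real.cos t + q ^ 2) := Real.le_sqrt_of_sq_le hD
  have hZ : Zf q t ≤ 1 / (1 - q) := by
    unfold Zf
    exact one_div_le_one_div_of_le hq1 hsD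
  have hqp0 : 0 < q ^ p := by positivity
  have hqp1 : q ^ p ≤ 1 := pow_le_one₀ h0.le h1.le
  have heq : (Zf q t) ^ 2 / Zf (q ^ p) ((p : ℝ) * t) =
        Real.sqrt (1 - 2 * q ^ p * Real.cos ((p : ℝ) * t) + q ^ (2 * p)) /
          (1 - 2 * q * Real.cos t + q ^ 2) := by
    unfold Zf
    rw [div_pow, Real.sq_sqrt hDpos.le, ← pow_mul, mul_comm p 2]
    simp only [one_pow, one_div, div_inv_eq_mul]
    rw [mul_comm, div_eq_mul_inv]
  refine ⟨heq, ?_, fun _ => hZ⟩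
  by_cases hp1 : p = 1
  · subst hp1
    have hZ0 : 0 < Zf q t := by
      unfold Zf
      positivity
    have : (Zf q t) ^ 2 / Zf (q ^ 1) (((1 : ℕ) : ℝ) * t) = Zf q t := by
      rw [pow_one, Nat.cast_one, one_mul, sq, mul_div_assoc, div_self hZ0.ne', mul_one]
    rw [this]
    simp only [δp, if_true]
    norm_num only [pow_one]
    refine hZ.trans ?_
    gcongr
    norm_num
  · rw [heq]
    simp only [δp, hp1, if_false]
    norm_num only
    have hN : Real.sqrt (1 - 2 * q ^ p * Real.cos ((p : ℝ) * t) + q ^ (2 * p)) ≤ 2 := by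
      rw [Real.sqrt_le_left (by norm_num), mul_comm 2 p, pow_mul]
      nlinarith [Real.neg_one_le_cos ((p : ℝ) * t)]
    gcongr
end
end

section
/- There exists an absolute constant C > 0 such that for all q ∈ (0,1), p ∈ ℕ and t ∈ ℝ, the derivative of the function t ↦ Z_q²(t)/Z_{q^p}(pt) = √(1 − 2q^p cos(pt) + q^{2p}) / (1 − 2q cos t + q²) satisfies | d/dt [ Z_q²(t)/Z_{q^p}(pt) ] | ≤ C · q/(1 − q)^{δ(p)}, where δ(p) = 2 if p = 1 and δ(p) = 3 if p ≥ 2. -/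
open Real MeasureTheory intervalIntegral

noncomputable section

/-- `|sin u|` is at most the distance from `1` to `r e^{iu}`. -/
theorem aux_sin_le (r u : ℝ) : |Real.sin u| ≤ Real.sqrt (1 - 2 * r * Real.cos u + r ^ 2) := by
  apply Real.abs_le_sqrt
  nlinarith [sq_nonneg (r - Real.cos u), Real.sin_sq_add_cos_sq u]

theorem aux_one_sub_le (r u : ℝ) (h0 : 0 < r) (_h1 : r < 1) :
    1 - r ≤ Real.sqrt (1 - 2 * r * Real.cos u + r ^ 2) := by
  apply Real.le_sqrt_of_sq_le
  nlinarith [Real.cos_le_one u]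

theorem aux_le_two (r u : ℝ) (h0 : 0 < r) (h1 : r < 1) :
    Real.sqrt (1 - 2 * r * Real.cos u + r ^ 2) ≤ 2 := by
  apply Real.sqrt_le_iff.mpr
  refine ⟨by norm_num, ?_⟩
  nlinarith [Real.neg_one_le_cos u]

theorem aux_pow (q : ℝ) (h0 : 0 < q) (h1 : q < 1) (n : ℕ) :
    ((n : ℝ) + 1) * q ^ n * (1 - q) ≤ 1 := by
  have h : ((n : ℝ) + 1) * q ^ n * (1 - q) ≤ 1 - q ^ (n + 1) := by
    induction n with
    | zero => simp
    | succ k ih =>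
      have hk : 0 < q ^ k := pow_pos h0 k
      have e : 1 - q ^ (k + 1 + 1) - ((((k + 1 : ℕ) : ℝ) + 1) * q ^ (k + 1) * (1 - q))
          = q * (1 - q ^ (k + 1) - ((k : ℝ) + 1) * q ^ k * (1 - q))
            + (1 - q) * (1 - q ^ (k + 1)) := by
        push_cast; ring
      have h2 : q ^ (k + 1) ≤ 1 := pow_le_one₀ h0.le h1.le
      have := mul_nonneg h0.le (sub_nonneg.mpr ih)
      have := mul_nonneg (sub_nonneg.mpr h1.le) (sub_nonneg.mpr h2)
      linarith
  have : 0 < q ^ (n + 1) := pow_pos h0 _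
  linarith

theorem aux_deriv (q r P t : ℝ) (hq0 : 0 < q) (hq1 : q < 1) (hr0 : 0 < r) (hr1 : r < 1)
    (hP : 0 ≤ P) :
    |deriv (fun s : ℝ => Real.sqrt (1 - 2 * r * Real.cos (P * s) + r ^ 2) /
        (1 - 2 * q * Real.cos s + q ^ 2)) t| ≤
      P * r / (1 - q) ^ 2 + 2 * q * Real.sqrt (1 - 2 * r * Real.cos (P * t) + r ^ 2) /
        Real.sqrt (1 - 2 * q * Real.cos t + q ^ 2) ^ 3 := by
  have hS := aux_one_sub_le r (P * t) hr0 hr1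
  have hd := aux_one_sub_le q t hq0 hq1
  have hsS := aux_sin_le r (P * t)
  have hsd := aux_sin_le q t
  have hA : 0 < 1 - 2 * r * Real.cos (P * t) + r ^ 2 :=
    Real.sqrt_pos.mp (lt_of_lt_of_le (by linarith) hS)
  have hD : 0 < 1 - 2 * q * Real.cos t + q ^ 2 :=
    Real.sqrt_pos.mp (lt_of_lt_of_le (by linarith) hd)
  have h1 : HasDerivAt (fun s : ℝ => 1 - 2 * r * Real.cos (P * s) + r ^ 2)
      (2 * r * P * Real.sin (P * t)) t := by
    have h := (((((hasDerivAt_id t).const_mul P).cos).const_mul (2 * r)).const_sub 1).add_const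
      (r ^ 2)
    exact h.congr_deriv (by simp; ring)
  have h2 : HasDerivAt (fun s : ℝ => 1 - 2 * q * Real.cos s + q ^ 2)
      (2 * q * Real.sin t) t := by
    have h := (((Real.hasDerivAt_cos t).const_mul (2 * q)).const_sub 1).add_const (q ^ 2)
    exact h.congr_deriv (by ring)
  have h3 := (h1.sqrt hA.ne').fun_div h2 hD.ne'
  rw [h3.deriv]
  have hDd := Real.sq_sqrt hD.le
  set S := Real.sqrt (1 - 2 * r * Real.cos (P * t) + r ^ 2) with hSdef
  set d := Real.sqrt (1 - 2 * q * Real.cos t + q ^ 2) with hddef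
  rw [← hDd]
  have hS0 : 0 < S := by linarith
  have hd0 : 0 < d := by linarith
  have e : (2 * r * P * Real.sin (P * t) / (2 * S) * d ^ 2 - S * (2 * q * Real.sin t)) /
      (d ^ 2) ^ 2 = P * r * (Real.sin (P * t) / S) / d ^ 2
        - 2 * q * S * (Real.sin t / d) / d ^ 3 := by
    field_simp
  rw [e]
  have b1 : |Real.sin (P * t) / S| ≤ 1 := by
    rw [abs_div, abs_of_pos hS0]; exact (div_le_one hS0).mpr hsS
  have b2 : |Real.sin t / d| ≤ 1 := by
    rw [abs_div, abs_of_pos hd0]; exact (div_le_one hd0).mpr hsd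
  refine (abs_sub _ _).trans (add_le_add ?_ ?_)
  · rw [abs_div, abs_mul, abs_of_nonneg (by positivity : 0 ≤ P * r),
      abs_of_pos (by positivity : 0 < d ^ 2)]
    have hq : 0 < 1 - q := by linarith
    apply div_le_div₀ (by positivity) (mul_le_of_le_one_right (by positivity) b1) (by positivity)
    gcongr
  · rw [abs_div, abs_mul, abs_of_pos (by positivity : 0 < 2 * q * S),
      abs_of_pos (by positivity : 0 < d ^ 3)]
    apply div_le_div_of_nonneg_right _ (by positivity)
    exact mul_le_of_le_one_right (by positivity) b2

/-- Uniform bound on the derivative of `t ↦ Z_q²(t)/Z_{q^p}(pt)`. -/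
theorem Zq_ratio_deriv_bound :
    ∃ C : ℝ, 0 < C ∧
      ∀ (q : ℝ) (p : ℕ) (t : ℝ), q ∈ Set.Ioo (0:ℝ) 1 → 0 < p →
        |deriv (fun s : ℝ =>
            Real.sqrt (1 - 2 * q ^ p * Real.cos ((p : ℝ) * s) + q ^ (2 * p)) /
              (1 - 2 * q * Real.cos s + q ^ 2)) t| ≤
          C * q / (1 - q) ^ δp p := by
  refine ⟨5, by norm_num, ?_⟩
  rintro q p t ⟨hq0, hq1⟩ hp
  have hr0 : 0 < q ^ p := pow_pos hq0 p
  have hr1 : q ^ p < 1 := pow_lt_one₀ hq0.le hq1 hp.ne'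
  have key := aux_deriv q (q ^ p) p t hq0 hq1 hr0 hr1 (Nat.cast_nonneg p)
  have e2 : q ^ (2 * p) = (q ^ p) ^ 2 := by rw [mul_comm, pow_mul]
  rw [e2]
  refine key.trans ?_
  have hx : 0 < 1 - q := by linarith
  have hd := aux_one_sub_le q t hq0 hq1
  have hd0 : 0 < Real.sqrt (1 - 2 * q * Real.cos t + q ^ 2) := by linarith
  by_cases h : p = 1
  · subst h
    simp only [δp, if_true, Nat.cast_one, one_mul, pow_one]
    set d := Real.sqrt (1 - 2 * q * Real.cos t + q ^ 2)
    have e : 2 * q * d / d ^ 3 = 2 * q / d ^ 2 := by field_simp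
    have h2 : 2 * q / d ^ 2 ≤ 2 * q / (1 - q) ^ 2 := by gcongr
    have h3 : 5 * q / (1 - q) ^ 2 = q / (1 - q) ^ 2 + 2 * q / (1 - q) ^ 2
      + 2 * q / (1 - q) ^ 2 := by ring
    have h4 : 0 < 2 * q / (1 - q) ^ 2 := by positivity
    rw [e]; linarith
  · simp only [δp, if_neg h]
    have hS := aux_le_two (q ^ p) (p * t) hr0 hr1
    set S := Real.sqrt (1 - 2 * q ^ p * Real.cos (p * t) + (q ^ p) ^ 2)
    set d := Real.sqrt (1 - 2 * q * Real.cos t + q ^ 2)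
    have h2 : 2 * q * S / d ^ 3 ≤ 2 * q * 2 / (1 - q) ^ 3 := by gcongr
    have h1 : (p : ℝ) * q ^ p / (1 - q) ^ 2 ≤ q / (1 - q) ^ 3 := by
      obtain ⟨n, rfl⟩ : ∃ n, p = n + 1 := ⟨p - 1, by omega⟩
      have hn := aux_pow q hq0 hq1 n
      rw [div_le_div_iff₀ (by positivity) (by positivity)]
      have : 0 ≤ q * (1 - q) ^ 2 * (1 - ((n : ℝ) + 1) * q ^ n * (1 - q)) :=
        mul_nonneg (by positivity) (by linarith)
      push_cast
      have e : ((n : ℝ) + 1) * q ^ (n + 1) * (1 - q) ^ 3 =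
        q * (1 - q) ^ 2 * (((n : ℝ) + 1) * q ^ n * (1 - q)) := by ring
      rw [e]; linarith
    have h3 : 5 * q / (1 - q) ^ 3 = q / (1 - q) ^ 3 + 2 * q * 2 / (1 - q) ^ 3 := by ring
    linarith
end
end

section
/- Let q ∈ (0,1), β ∈ ℝ, n,p ∈ ℕ with n − p ≥ 6/(1−q), set α_q = ⌊3q/(1−q)⌋ + 2, and define y₁(t) = t + (1/(n−p+α_q)) · ( 2θ_q(t) − θ_{q^p}(pt) + (1 − α_q) t + βπ/2 ). Then y₁ is differentiable on ℝ and 1/3 < y₁′(t) < 1 for all t ∈ ℝ; in particular y₁ is strictly increasing and has a differentiable inverse. -/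
open Real MeasureTheory intervalIntegral

noncomputable section

lemma den_pos_aux {r : ℝ} (h0 : 0 < r) (h1 : r < 1) (u : ℝ) :
    0 < 1 - 2 * r * Real.cos u + r ^ 2 := by
  nlinarith [Real.cos_le_one u, sq_nonneg (1 - r), mul_pos h0 h0, mul_pos (sub_pos.2 h1) (sub_pos.2 h1)]

lemma den1_pos_aux {r : ℝ} (h0 : 0 < r) (h1 : r < 1) (u : ℝ) :
    0 < 1 - r * Real.cos u := by
  nlinarith [Real.cos_le_one u]

lemma θf_hasDerivAt {r : ℝ} (h0 : 0 < r) (h1 : r < 1) (u : ℝ) :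
    HasDerivAt (θf r) ((r * Real.cos u - r ^ 2) / (1 - 2 * r * Real.cos u + r ^ 2)) u := by
  have hd := den1_pos_aux h0 h1 u
  have hD := den_pos_aux h0 h1 u
  have ha : HasDerivAt (fun u => r * Real.sin u) (r * Real.cos u) u :=
    (Real.hasDerivAt_sin u).const_mul r
  have hb : HasDerivAt (fun u => 1 - r * Real.cos u) (-(r * (-Real.sin u))) u :=
    ((Real.hasDerivAt_cos u).const_mul r).const_sub 1
  have h := (ha.div hb hd.ne').arctan
  refine h.congr_deriv ?_
  have hs : Real.sin u ^ 2 = 1 - Real.cos u ^ 2 := Real.sin_sq u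
  have e1 : (1 - r * Real.cos u) ^ 2 + (r * Real.sin u) ^ 2 = 1 - 2 * r * Real.cos u + r ^ 2 := by
    rw [mul_pow r (Real.sin u), hs]; ring
  have e2 : 1 + (r * Real.sin u / (1 - r * Real.cos u)) ^ 2
      = (1 - 2 * r * Real.cos u + r ^ 2) / (1 - r * Real.cos u) ^ 2 := by
    rw [← e1]; field_simp
  have e3 : r * Real.cos u * (1 - r * Real.cos u) - r * Real.sin u * (-(r * (-Real.sin u)))
      = r * Real.cos u - r ^ 2 := by
    linear_combination (-r ^ 2) * hs
  simp only [Pi.div_apply]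
  rw [e2, e3]
  field_simp

lemma thetaDeriv_le {r : ℝ} (h0 : 0 < r) (h1 : r < 1) (u : ℝ) :
    (r * Real.cos u - r ^ 2) / (1 - 2 * r * Real.cos u + r ^ 2) ≤ r / (1 - r) := by
  rw [div_le_div_iff₀ (den_pos_aux h0 h1 u) (by linarith)]
  have := mul_nonneg (mul_nonneg h0.le (by linarith : 0 ≤ 1 + r)) (sub_nonneg.2 (Real.cos_le_one u))
  nlinarith

lemma le_thetaDeriv {r : ℝ} (h0 : 0 < r) (h1 : r < 1) (u : ℝ) :
    -(r / (1 + r)) ≤ (r * Real.cos u - r ^ 2) / (1 - 2 * r * Real.cos u + r ^ 2) := by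
  rw [← neg_div, div_le_div_iff₀ (by linarith) (den_pos_aux h0 h1 u)]
  have := mul_nonneg (mul_nonneg h0.le (by linarith : 0 ≤ 1 - r))
    (by linarith [Real.neg_one_le_cos u] : 0 ≤ 1 + Real.cos u)
  nlinarith

lemma pow_aux {q : ℝ} (h0 : 0 < q) (h1 : q < 1) (k : ℕ) :
    (k : ℝ) * q ^ k * (1 - q) ≤ q * (1 - q ^ k) := by
  induction k with
  | zero => simp
  | succ k ih =>
    have hk : q ^ k ≤ 1 := pow_le_one₀ h0.le h1.le
    have := mul_nonneg (mul_nonneg h0.le (sub_nonneg.2 h1.le)) (sub_nonneg.2 hk)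
    have := mul_le_mul_of_nonneg_left ih h0.le
    push_cast
    rw [pow_succ]
    nlinarith

/-- The change-of-variables function
`y₁(t) = t + (1/(n-p+α_q))(2θ_q(t) - θ_{q^p}(pt) + (1-α_q)t + βπ/2)` is differentiable
with `1/3 < y₁′(t) < 1`; in particular it is strictly increasing, bijective, and has a
differentiable inverse. -/
theorem y1_deriv_bounds (q β : ℝ) (hq : q ∈ Set.Ioo (0:ℝ) 1) (n p : ℕ) (hp : 0 < p)
    (h6 : 6 / (1 - q) ≤ (n : ℝ) - (p : ℝ)) (y₁ : ℝ → ℝ)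
    (hy₁ : y₁ = fun t =>
      t + (1 / ((n : ℝ) - (p : ℝ) + (αq q : ℝ))) *
        (2 * θf q t - θf (q ^ p) ((p : ℝ) * t) + (1 - (αq q : ℝ)) * t + β * π / 2)) :
    (∀ t : ℝ, DifferentiableAt ℝ y₁ t) ∧
      (∀ t : ℝ, 1 / 3 < deriv y₁ t ∧ deriv y₁ t < 1) ∧
      StrictMono y₁ ∧ Function.Bijective y₁ ∧
      ∀ t : ℝ, DifferentiableAt ℝ (Function.invFun y₁) t := by
  obtain ⟨h0, h1⟩ := hq
  have h1q : 0 < 1 - q := by linarith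
  have hr0 : 0 < q ^ p := pow_pos h0 p
  have hr1 : q ^ p < 1 := pow_lt_one₀ h0.le h1 hp.ne'
  have hpp : (0 : ℝ) < p := by exact_mod_cast hp
  set x := q / (1 - q) with hx
  have hx0 : 0 < x := by positivity
  have hinv : 1 / (1 - q) = 1 + x := by rw [hx]; field_simp; ring
  have h6' : 6 * (1 + x) ≤ (n : ℝ) - p := by
    rw [← hinv]; convert h6 using 1; ring
  have hα1 : (αq q : ℝ) ≤ 3 * x + 2 := by
    have := Nat.floor_le (a := 3 * q / (1 - q)) (by positivity)
    have e : 3 * q / (1 - q) = 3 * x := by rw [hx]; ring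
    unfold αq
    push_cast
    linarith
  have hα2 : 3 * x + 1 < (αq q : ℝ) := by
    have := Nat.lt_floor_add_one (3 * q / (1 - q))
    have e : 3 * q / (1 - q) = 3 * x := by rw [hx]; ring
    unfold αq
    push_cast
    linarith
  set α : ℝ := (αq q : ℝ) with hα
  have hN : 0 < (n : ℝ) - p + α := by linarith
  have key1 : (p : ℝ) * (q ^ p / (1 - q ^ p)) ≤ x := by
    rw [hx, ← mul_div_assoc, div_le_div_iff₀ (by linarith) h1q]
    exact pow_aux h0 h1 p
  have key2 : (p : ℝ) * (q ^ p / (1 + q ^ p)) ≤ x := by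
    refine le_trans (mul_le_mul_of_nonneg_left ?_ hpp.le) key1
    exact div_le_div_of_nonneg_left hr0.le (by linarith) (by linarith)
  have hq1 : q / (1 + q) < 1 := by rw [div_lt_one (by linarith)]; linarith
  set A : ℝ → ℝ := fun t => (q * Real.cos t - q ^ 2) / (1 - 2 * q * Real.cos t + q ^ 2) with hA
  set B : ℝ → ℝ := fun t => (q ^ p * Real.cos t - (q ^ p) ^ 2) /
    (1 - 2 * q ^ p * Real.cos t + (q ^ p) ^ 2) with hB
  have hder : ∀ t, HasDerivAt y₁
      (1 + (1 / ((n : ℝ) - p + α)) * (2 * A t - p * B (p * t) + (1 - α))) t := by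
    intro t
    have hAt : HasDerivAt (θf q) (A t) t := θf_hasDerivAt h0 h1 t
    have hlin : HasDerivAt (fun t : ℝ => (p : ℝ) * t) (p : ℝ) t := by
      simpa using (hasDerivAt_id t).const_mul (p : ℝ)
    have hBt : HasDerivAt (fun t => θf (q ^ p) ((p : ℝ) * t)) (B (p * t) * p) t :=
      (θf_hasDerivAt hr0 hr1 ((p : ℝ) * t)).comp t hlin
    have hl2 : HasDerivAt (fun t : ℝ => (1 - α) * t) (1 - α) t := by
      simpa using (hasDerivAt_id t).const_mul (1 - α)
    rw [hy₁]
    refine ((hasDerivAt_id t).add (((((hAt.const_mul 2).sub hBt).add hl2).add_const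
      (β * π / 2)).const_mul (1 / ((n : ℝ) - p + α)))).congr_deriv ?_
    ring
  have hdiff : ∀ t, DifferentiableAt ℝ y₁ t := fun t => (hder t).differentiableAt
  have hbd : ∀ t, 1 / 3 < deriv y₁ t ∧ deriv y₁ t < 1 := by
    intro t
    rw [(hder t).deriv]
    have a1 : A t ≤ x := thetaDeriv_le h0 h1 t
    have a2 : -(q / (1 + q)) ≤ A t := le_thetaDeriv h0 h1 t
    have b1 : (p : ℝ) * B (p * t) ≤ x :=
      le_trans (mul_le_mul_of_nonneg_left (thetaDeriv_le hr0 hr1 _) hpp.le) key1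
    have b2 : -x ≤ (p : ℝ) * B (p * t) := by
      have := mul_le_mul_of_nonneg_left (le_thetaDeriv hr0 hr1 ((p : ℝ) * t)) hpp.le
      have hthis : (p : ℝ) * -(q ^ p / (1 + q ^ p)) ≤ p * B (p * t) := this
      linarith
    rw [one_div_mul_eq_div]
    constructor
    · have : -(2 / 3) < (2 * A t - p * B (p * t) + (1 - α)) / ((n : ℝ) - p + α) := by
        rw [lt_div_iff₀ hN]
        linarith
      linarith
    · have : (2 * A t - p * B (p * t) + (1 - α)) / ((n : ℝ) - p + α) < 0 :=
        div_neg_of_neg_of_pos (by linarith) hN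
      linarith
  have hmono : StrictMono y₁ := strictMono_of_deriv_pos fun t => by linarith [(hbd t).1]
  have hcont : Continuous y₁ := continuous_iff_continuousAt.2 fun t => (hdiff t).continuousAt
  have hg : Monotone (fun t => y₁ t - (1 / 3) * t) := by
    have hgd : ∀ t, HasDerivAt (fun t => y₁ t - (1 / 3) * t) (deriv y₁ t - 1 / 3) t := by
      intro t
      exact ((hdiff t).hasDerivAt.sub ((hasDerivAt_id t).const_mul (1 / 3 : ℝ))).congr_deriv (by ring)
    refine monotone_of_deriv_nonneg (fun t => (hgd t).differentiableAt) fun t => ?_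
    rw [(hgd t).deriv]
    linarith [(hbd t).1]
  have hsurj : Function.Surjective y₁ := by
    refine hcont.surjective ?_ ?_
    · refine Filter.tendsto_atTop.2 fun b => ?_
      filter_upwards [Filter.eventually_ge_atTop (max 0 (3 * (b - y₁ 0)))] with t ht
      have h := hg (le_trans (le_max_left _ _) ht)
      have h2 := le_trans (le_max_right _ _) ht
      simp only at h
      linarith
    · refine Filter.tendsto_atBot.2 fun b => ?_
      filter_upwards [Filter.eventually_le_atBot (min 0 (3 * (b - y₁ 0)))] with t ht
      have h := hg (le_trans ht (min_le_left _ _))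
      have h2 := le_trans ht (min_le_right _ _)
      simp only at h
      linarith
  refine ⟨hdiff, hbd, hmono, ⟨hmono.injective, hsurj⟩, fun s => ?_⟩
  have hri : ∀ s, y₁ (Function.invFun y₁ s) = s := Function.rightInverse_invFun hsurj
  let e := hmono.orderIsoOfSurjective y₁ hsurj
  have heq : Function.invFun y₁ = e.symm := by
    funext s
    apply hmono.injective
    rw [hri]
    exact (e.apply_symm_apply s).symm
  have hic : Continuous (Function.invFun y₁) := by
    rw [heq]; exact e.symm.continuous
  exact (HasDerivAt.of_local_left_inverse hic.continuousAt (hdiff _).hasDerivAt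
    (by linarith [(hbd (Function.invFun y₁ s)).1] : (0:ℝ) < deriv y₁ (Function.invFun y₁ s)).ne'
    (Filter.Eventually.of_forall hri)).differentiableAt
end
end
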